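/- For |q|<1, (q;q)_∞/(-q;q)_∞ = J_{9,18} − 2q·J_{3,18}, where J_{a,m} := (q^a;q^m)_∞ (q^{m-a};q^m)_∞ (q^m;q^m)_∞. -/

import Mathlib

open scoped BigOperators

noncomputable def poch (a q : ℂ) : ℂ := ∏' n : ℕ, (1 - a * q ^ n)

noncomputable def Jm (m : ℕ) (q : ℂ) : ℂ := poch (q ^ m) (q ^ m)

noncomputable def Jam (a m : ℕ) (q : ℂ) : ℂ :=
  poch (q ^ a) (q ^ m) * poch (q ^ (m - a)) (q ^ m) * poch (q ^ m) (q ^ m)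

noncomputable def Sser (a Q : ℂ) : ℂ :=
  ∑' n : ℕ, (1 / (1 - a * Q ^ n) - 1 / (1 - a⁻¹ * Q ^ (n + 1)))

open Filter Topology

lemma multipliable_one_sub_mul_pow (a : ℂ) {P : ℂ} (hP : ‖P‖ < 1) :
    Multipliable fun n : ℕ ↦ 1 - a * P ^ n := by
  simp_rw [sub_eq_add_neg]
  apply multipliable_one_add_of_summable
  simpa using (summable_geometric_of_lt_one (norm_nonneg _) hP).mul_left ‖a‖

lemma tendsto_prod_poch (a : ℂ) {P : ℂ} (hP : ‖P‖ < 1) :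
    Tendsto (fun n ↦ ∏ i ∈ Finset.range n, (1 - a * P ^ i)) atTop (𝓝 (poch a P)) :=
  (multipliable_one_sub_mul_pow a hP).tendsto_prod_tprod_nat

lemma one_sub_mul_pow_ne_zero {P : ℂ} (hP : ‖P‖ < 1) (n : ℕ) : 1 - P * P ^ n ≠ 0 := by
  rw [← pow_succ', sub_ne_zero]
  intro h
  have h1 : ‖P‖ ^ (n + 1) < 1 := pow_lt_one₀ (norm_nonneg _) hP n.succ_ne_zero
  rw [← norm_pow, ← h, norm_one] at h1
  exact lt_irrefl _ h1

lemma poch_self_ne_zero {P : ℂ} (hP : ‖P‖ < 1) : poch P P ≠ 0 := by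
  unfold poch
  simp_rw [sub_eq_add_neg]
  apply tprod_one_add_ne_zero_of_summable
  · intro i
    simpa [sub_eq_add_neg] using one_sub_mul_pow_ne_zero hP i
  · simpa using (summable_geometric_of_lt_one (norm_nonneg _) hP).mul_left ‖P‖

/-- The reciprocal `1 / (P; P)_m`, extended by zero to negative `m`. -/
noncomputable def invPoch (P : ℂ) (m : ℤ) : ℂ :=
  if 0 ≤ m then (∏ i ∈ Finset.range m.toNat, (1 - P * P ^ i))⁻¹ else 0

lemma invPoch_natCast (P : ℂ) (n : ℕ) :
    invPoch P n = (∏ i ∈ Finset.range n, (1 - P * P ^ i))⁻¹ := by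
  simp [invPoch]

lemma invPoch_sub_one {P : ℂ} (hP : ‖P‖ < 1) (m : ℤ) :
    invPoch P (m - 1) = (1 - P ^ m) * invPoch P m := by
  rcases lt_trichotomy m 0 with h | rfl | h
  · rw [invPoch, invPoch, if_neg (by omega), if_neg (by omega), mul_zero]
  · simp [invPoch]
  · obtain ⟨n, rfl⟩ : ∃ n : ℕ, m = n + 1 := ⟨(m - 1).toNat, by omega⟩
    have h0 := one_sub_mul_pow_ne_zero hP n
    have h1 : invPoch P (n + 1) = (∏ i ∈ Finset.range (n + 1), (1 - P * P ^ i))⁻¹ :=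
      mod_cast invPoch_natCast P (n + 1)
    have h2 : P ^ ((n : ℤ) + 1) = P * P ^ n := by
      rw [← pow_succ']
      exact_mod_cast zpow_natCast P (n + 1)
    rw [add_sub_cancel_right, invPoch_natCast, h1, h2, Finset.prod_range_succ, mul_inv]
    field_simp

lemma tendsto_invPoch {P : ℂ} (hP : ‖P‖ < 1) :
    Tendsto (invPoch P) atTop (𝓝 (poch P P)⁻¹) := by
  have h := (tendsto_prod_poch P hP).inv₀ (poch_self_ne_zero hP)
  have hnat : Tendsto Int.toNat atTop atTop :=
    tendsto_atTop_atTop.mpr fun b ↦ ⟨b, fun a ha ↦ by omega⟩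
  refine (h.comp hnat).congr' ?_
  filter_upwards [eventually_ge_atTop 0] with m hm
  simp [invPoch, hm]

lemma exists_norm_invPoch_le {P : ℂ} (hP : ‖P‖ < 1) : ∃ C, ∀ m, ‖invPoch P m‖ ≤ C := by
  have h := (tendsto_prod_poch P hP).inv₀ (poch_self_ne_zero hP)
  obtain ⟨C, hC⟩ := h.norm.bddAbove_range
  refine ⟨C, fun m ↦ ?_⟩
  have h' : ∀ n : ℕ, ‖(∏ i ∈ Finset.range n, (1 - P * P ^ i))⁻¹‖ ≤ C :=
    fun n ↦ hC ⟨n, rfl⟩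
  rw [invPoch]
  split_ifs
  · exact h' _
  · simpa using (norm_nonneg _).trans (h' 0)

/-- The coefficient of `x ^ k` in the finite Jacobi triple product. -/
noncomputable def tripleCoeff (Q : ℂ) (n : ℕ) (k : ℤ) : ℂ :=
  (∏ i ∈ Finset.range (2 * n), (1 - Q ^ 2 * (Q ^ 2) ^ i)) *
    invPoch (Q ^ 2) (n - k) * invPoch (Q ^ 2) (n + k)

/-- The general term of the theta series `∑ (-1) ^ k * x ^ k * Q ^ (k ^ 2)`. -/
noncomputable def thetaTerm (x Q : ℂ) (k : ℤ) : ℂ := (-1) ^ k * x ^ k * Q ^ (k ^ 2)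

lemma norm_sq_lt_one {Q : ℂ} (hQ : ‖Q‖ < 1) : ‖Q ^ 2‖ < 1 := by
  rw [norm_pow]
  exact pow_lt_one₀ (norm_nonneg _) hQ two_ne_zero

lemma tripleCoeff_succ {Q : ℂ} (hQ0 : Q ≠ 0) (hQ : ‖Q‖ < 1) (n : ℕ) (k : ℤ) :
    tripleCoeff Q (n + 1) k = (1 + Q ^ (4 * n + 2)) * tripleCoeff Q n k +
      (Q ^ 2) ^ (n + 1 - k : ℤ) * tripleCoeff Q n (k - 1) +
      (Q ^ 2) ^ (n + 1 + k : ℤ) * tripleCoeff Q n (k + 1) := by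
  have hP := norm_sq_lt_one hQ
  have hP0 : Q ^ 2 ≠ 0 := pow_ne_zero _ hQ0
  have e0 : Q ^ (4 * n + 2) = (Q ^ 2) ^ (2 * n + 1) := by ring
  unfold tripleCoeff
  rw [e0, show 2 * (n + 1) = 2 * n + 1 + 1 by ring, Finset.prod_range_succ,
    Finset.prod_range_succ]
  generalize Q ^ 2 = P at *
  have u1 := invPoch_sub_one hP (n + 1 - k)
  have u2 := invPoch_sub_one hP (n + 1 - k - 1)
  have v1 := invPoch_sub_one hP (n + 1 + k)
  have v2 := invPoch_sub_one hP (n + 1 + k - 1)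
  have w : P * P * P ^ (2 * n) = P ^ (n + 1 - k : ℤ) * P ^ (n + 1 + k : ℤ) := by
    rw [← zpow_add₀ hP0, ← pow_two, ← pow_add, ← zpow_natCast]
    congr 1
    push_cast
    ring
  rw [zpow_sub_one₀ hP0, u1] at u2
  rw [zpow_sub_one₀ hP0, v1] at v2
  push_cast
  rw [show (n : ℤ) - k = n + 1 - k - 1 by ring, show (n : ℤ) + k = n + 1 + k - 1 by ring,
    show (n : ℤ) - (k - 1) = n + 1 - k by ring, show (n : ℤ) - (k + 1) = n + 1 - k - 1 - 1 by ring,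
    show (n : ℤ) + (k - 1) = n + 1 + k - 1 - 1 by ring, show (n : ℤ) + (k + 1) = n + 1 + k by ring,
    u2, v2, u1, v1, pow_succ P (2 * n)]
  have w' : P ^ (2 * n) = P ^ (n + 1 - k : ℤ) * P ^ (n + 1 + k : ℤ) * P⁻¹ * P⁻¹ := by
    rw [← w]; field_simp
  rw [w']
  field_simp
  ring

lemma thetaTerm_sub_one {x Q : ℂ} (hx : x ≠ 0) (hQ0 : Q ≠ 0) (n : ℕ) (k : ℤ) :
    x * Q ^ (2 * n + 1) * thetaTerm x Q (k - 1) =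
      -((Q ^ 2) ^ (n + 1 - k : ℤ) * thetaTerm x Q k) := by
  have e : Q ^ (2 * n + 1) * Q ^ ((k - 1) ^ 2) =
      (Q ^ 2) ^ (n + 1 - k : ℤ) * Q ^ (k ^ 2) := by
    rw [← zpow_natCast, ← zpow_natCast, ← zpow_mul, ← zpow_add₀ hQ0, ← zpow_add₀ hQ0]
    congr 1
    push_cast
    ring
  unfold thetaTerm
  rw [zpow_sub_one₀ (by norm_num), zpow_sub_one₀ hx]
  calc _ = (x * x⁻¹) * (-1) ^ k * (-1)⁻¹ * x ^ k * (Q ^ (2 * n + 1) * Q ^ ((k - 1) ^ 2)) := by ring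
    _ = _ := by rw [e, mul_inv_cancel₀ hx, inv_neg_one]; ring

lemma thetaTerm_add_one {x Q : ℂ} (hx : x ≠ 0) (hQ0 : Q ≠ 0) (n : ℕ) (k : ℤ) :
    x⁻¹ * Q ^ (2 * n + 1) * thetaTerm x Q (k + 1) =
      -((Q ^ 2) ^ (n + 1 + k : ℤ) * thetaTerm x Q k) := by
  have e : Q ^ (2 * n + 1) * Q ^ ((k + 1) ^ 2) =
      (Q ^ 2) ^ (n + 1 + k : ℤ) * Q ^ (k ^ 2) := by
    rw [← zpow_natCast, ← zpow_natCast, ← zpow_mul, ← zpow_add₀ hQ0, ← zpow_add₀ hQ0]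
    congr 1
    push_cast
    ring
  unfold thetaTerm
  rw [zpow_add_one₀ (by norm_num), zpow_add_one₀ hx]
  calc _ = -(x * x⁻¹) * (-1) ^ k * x ^ k * (Q ^ (2 * n + 1) * Q ^ ((k + 1) ^ 2)) := by ring
    _ = _ := by rw [e, mul_inv_cancel₀ hx]; ring

/-- The finite form of the Jacobi triple product. -/
lemma hasSum_finite_triple {x Q : ℂ} (hx : x ≠ 0) (hQ0 : Q ≠ 0) (hQ : ‖Q‖ < 1) (n : ℕ) :
    HasSum (fun k ↦ tripleCoeff Q n k * thetaTerm x Q k)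
      (∏ i ∈ Finset.range n, ((1 - x * Q * (Q ^ 2) ^ i) * (1 - x⁻¹ * Q * (Q ^ 2) ^ i))) := by
  induction n with
  | zero =>
    convert hasSum_single (0 : ℤ) ?_ using 1
    · simp [tripleCoeff, invPoch, thetaTerm]
    · intro k hk
      rcases hk.lt_or_gt with h | h
      · simp [tripleCoeff, invPoch, h]
      · simp [tripleCoeff, invPoch, h]
  | succ n ih =>
    have h1 := (Equiv.subRight (1 : ℤ)).hasSum_iff.mpr ih
    have h2 := (Equiv.addRight (1 : ℤ)).hasSum_iff.mpr ih
    have h := ((ih.mul_left (1 + Q ^ (4 * n + 2))).sub (h1.mul_left (x * Q ^ (2 * n + 1)))).sub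
      (h2.mul_left (x⁻¹ * Q ^ (2 * n + 1)))
    have hS : ∀ S : ℂ, S * ((1 - x * Q * (Q ^ 2) ^ n) * (1 - x⁻¹ * Q * (Q ^ 2) ^ n)) =
        (1 + Q ^ (4 * n + 2)) * S - x * Q ^ (2 * n + 1) * S - x⁻¹ * Q ^ (2 * n + 1) * S := by
      intro S
      have e : x * x⁻¹ = 1 := mul_inv_cancel₀ hx
      linear_combination (S * Q ^ 2 * (Q ^ 2) ^ n * (Q ^ 2) ^ n) * e
    rw [Finset.prod_range_succ, hS]
    refine h.congr_fun fun k ↦ ?_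
    have a := thetaTerm_sub_one hx hQ0 n k
    have b := thetaTerm_add_one hx hQ0 n k
    simp only [Function.comp_apply, Equiv.subRight_apply, Equiv.coe_addRight]
    rw [tripleCoeff_succ hQ0 hQ]
    linear_combination tripleCoeff Q n (k - 1) * a + tripleCoeff Q n (k + 1) * b

lemma summable_thetaTerm {x Q : ℂ} (hx : x ≠ 0) (hQ0 : Q ≠ 0) (hQ : ‖Q‖ < 1) :
    Summable (thetaTerm x Q) := by
  set z : ℂ := Complex.log (-x) / (2 * Real.pi * Complex.I) with hz
  set τ : ℂ := Complex.log Q / (Real.pi * Complex.I) with hτ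
  have hpi : (Real.pi : ℂ) ≠ 0 := mod_cast Real.pi_ne_zero
  have him : 0 < τ.im := by
    have : τ = -(Complex.I * (Complex.log Q / (Real.pi : ℝ))) := by
      rw [hτ]
      field_simp
      simp
    rw [this, Complex.neg_im, Complex.I_mul_im, Complex.div_ofReal_re, Complex.log_re, neg_pos]
    exact div_neg_of_neg_of_pos (Real.log_neg (norm_pos_iff.mpr hQ0) hQ) Real.pi_pos
  convert (summable_jacobiTheta₂_term_iff z τ).mpr him using 1
  ext k
  have e1 : 2 * Real.pi * Complex.I * k * z = k * Complex.log (-x) := by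
    rw [hz]
    field_simp
  have e2 : Real.pi * Complex.I * k ^ 2 * τ = (k ^ 2 : ℤ) * Complex.log Q := by
    rw [hτ]
    push_cast
    field_simp
  rw [jacobiTheta₂_term, e1, e2, Complex.exp_add, Complex.exp_int_mul, Complex.exp_int_mul,
    Complex.exp_log hQ0, Complex.exp_log (neg_ne_zero.mpr hx), thetaTerm, ← mul_zpow, neg_one_mul]

/-- The Jacobi triple product identity. -/
theorem tsum_thetaTerm {x Q : ℂ} (hx : x ≠ 0) (hQ0 : Q ≠ 0) (hQ : ‖Q‖ < 1) :
    ∑' k, thetaTerm x Q k = poch (x * Q) (Q ^ 2) * poch (x⁻¹ * Q) (Q ^ 2) *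
      poch (Q ^ 2) (Q ^ 2) := by
  have hP := norm_sq_lt_one hQ
  have hne := poch_self_ne_zero hP
  have hA : Tendsto (fun n : ℕ ↦ ∏ i ∈ Finset.range (2 * n), (1 - Q ^ 2 * (Q ^ 2) ^ i)) atTop
      (𝓝 (poch (Q ^ 2) (Q ^ 2))) :=
    (tendsto_prod_poch (Q ^ 2) hP).comp (tendsto_id.const_mul_atTop' two_pos)
  obtain ⟨C, hC⟩ := exists_norm_invPoch_le hP
  obtain ⟨D, hD⟩ := hA.norm.bddAbove_range
  have hC0 : 0 ≤ C := (norm_nonneg _).trans (hC 0)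
  have hD0 : 0 ≤ D := (norm_nonneg _).trans (hD ⟨0, rfl⟩)
  have hsum : Tendsto (fun n ↦ ∑' k, tripleCoeff Q n k * thetaTerm x Q k) atTop
      (𝓝 (∑' k, (poch (Q ^ 2) (Q ^ 2))⁻¹ * thetaTerm x Q k)) := by
    refine tendsto_tsum_of_dominated_convergence
      ((summable_thetaTerm hx hQ0 hQ).norm.mul_left (D * C * C)) (fun k ↦ ?_)
      (Eventually.of_forall fun n k ↦ ?_)
    · refine Tendsto.mul_const _ ?_
      have h1 := (tendsto_invPoch hP).comp
        (tendsto_atTop_add_const_right _ (-k) (tendsto_natCast_atTop_atTop (R := ℤ)))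
      have h2 := (tendsto_invPoch hP).comp
        (tendsto_atTop_add_const_right _ k (tendsto_natCast_atTop_atTop (R := ℤ)))
      have h := (hA.mul h1).mul h2
      rwa [mul_inv_cancel₀ hne, one_mul] at h
    · rw [norm_mul, tripleCoeff, norm_mul, norm_mul]
      gcongr
      · exact hD ⟨n, rfl⟩
      · exact hC _
      · exact hC _
  have hprod : Tendsto (fun n ↦ ∑' k, tripleCoeff Q n k * thetaTerm x Q k) atTop
      (𝓝 (poch (x * Q) (Q ^ 2) * poch (x⁻¹ * Q) (Q ^ 2))) := by
    simp_rw [fun n ↦ (hasSum_finite_triple hx hQ0 hQ n).tsum_eq, Finset.prod_mul_distrib]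
    exact (tendsto_prod_poch _ hP).mul (tendsto_prod_poch _ hP)
  rw [tendsto_nhds_unique hprod hsum, tsum_mul_left]
  field_simp

lemma poch_eq_even_mul_odd (a : ℂ) {q : ℂ} (hq : ‖q‖ < 1) :
    poch a q = poch a (q ^ 2) * poch (a * q) (q ^ 2) := by
  have hP := norm_sq_lt_one hq
  unfold poch
  rw [← tprod_even_mul_odd (f := fun n ↦ 1 - a * q ^ n)]
  · congr! 3 with n
    · rw [pow_mul]
    · ring
  · simpa only [pow_mul] using multipliable_one_sub_mul_pow a hP
  · simpa only [pow_succ', pow_mul, mul_assoc] using multipliable_one_sub_mul_pow (a * q) hP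

lemma poch_mul_poch_neg (a : ℂ) {q : ℂ} (hq : ‖q‖ < 1) :
    poch a q * poch (-a) q = poch (a ^ 2) (q ^ 2) := by
  unfold poch
  rw [← (multipliable_one_sub_mul_pow a hq).tprod_mul (multipliable_one_sub_mul_pow (-a) hq)]
  congr 1
  ext n
  ring

/-- Gauss's product for the theta series `∑ (-1) ^ k * q ^ (k ^ 2)`. -/
lemma tsum_thetaTerm_one {q : ℂ} (hq0 : q ≠ 0) (hq : ‖q‖ < 1) :
    ∑' k, thetaTerm 1 q k = poch q q / poch (-q) q := by
  have h1 := poch_eq_even_mul_odd q hq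
  have h2 := poch_mul_poch_neg q hq
  have hne := poch_self_ne_zero (norm_sq_lt_one hq)
  rw [← pow_two] at h1
  have hneg : poch (-q) q ≠ 0 := right_ne_zero_of_mul (h2 ▸ hne)
  have h3 : poch q (q ^ 2) * poch (-q) q = 1 := by
    apply mul_right_cancel₀ hne
    rw [h1] at h2
    linear_combination h2
  rw [tsum_thetaTerm one_ne_zero hq0 hq, eq_div_iff hneg, inv_one, one_mul, h1]
  linear_combination (poch q (q ^ 2) * poch (q ^ 2) (q ^ 2)) * h3

/-- The trisection of the theta series `∑ (-1) ^ k * q ^ (k ^ 2)`. -/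
lemma tsum_thetaTerm_trisection {q : ℂ} (hq0 : q ≠ 0) (hq : ‖q‖ < 1) :
    ∑' k, thetaTerm 1 q k =
      ∑' k, thetaTerm 1 (q ^ 9) k - 2 * q * ∑' k, thetaTerm (q ^ 6)⁻¹ (q ^ 9) k := by
  have hq9 : ‖q ^ 9‖ < 1 := by
    rw [norm_pow]
    exact pow_lt_one₀ (norm_nonneg _) hq (by norm_num)
  have h9 : q ^ 9 ≠ 0 := pow_ne_zero _ hq0
  have s0 := (summable_thetaTerm one_ne_zero h9 hq9).hasSum
  have s1 := (summable_thetaTerm (inv_ne_zero (pow_ne_zero 6 hq0)) h9 hq9).hasSum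
  have hterm (k : ℤ) : thetaTerm (q ^ 6)⁻¹ (q ^ 9) k = (-1) ^ k * q ^ (9 * k ^ 2 - 6 * k) := by
    rw [thetaTerm, inv_zpow', ← zpow_natCast q, ← zpow_natCast q, ← zpow_mul, ← zpow_mul, mul_assoc,
      ← zpow_add₀ hq0]
    congr 2
    push_cast
    ring
  have t0 : HasSum (fun m : ℤ ↦ thetaTerm 1 q (3 * m)) (∑' k, thetaTerm 1 (q ^ 9) k) := by
    convert s0 using 2 with m
    have e : q ^ ((3 * m) ^ 2) = (q ^ 9) ^ (m ^ 2) := by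
      rw [← zpow_natCast q, ← zpow_mul]
      congr 1
      push_cast
      ring
    rw [thetaTerm, thetaTerm, e, zpow_mul]
    norm_num
  have t1 : HasSum (fun m : ℤ ↦ thetaTerm 1 q (3 * m + 1))
      (-q * ∑' k, thetaTerm (q ^ 6)⁻¹ (q ^ 9) k) := by
    refine (((Equiv.neg ℤ).hasSum_iff.mpr s1).mul_left (-q)).congr_fun fun m ↦ ?_
    simp only [Function.comp_apply, Equiv.neg_apply]
    rw [hterm, thetaTerm, one_zpow, mul_one, zpow_add₀ (by norm_num), zpow_mul,
      show (3 * m + 1) ^ 2 = 1 + (9 * (-m) ^ 2 - 6 * (-m)) by ring, zpow_add₀ hq0, zpow_neg,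
      ← inv_zpow]
    norm_num
    ring
  have t2 : HasSum (fun m : ℤ ↦ thetaTerm 1 q (3 * m + 2))
      (-q * ∑' k, thetaTerm (q ^ 6)⁻¹ (q ^ 9) k) := by
    refine (((Equiv.addRight (1 : ℤ)).hasSum_iff.mpr s1).mul_left (-q)).congr_fun fun m ↦ ?_
    simp only [Function.comp_apply, Equiv.coe_addRight]
    rw [hterm, thetaTerm, one_zpow, mul_one, zpow_add₀ (by norm_num), zpow_mul,
      show (3 * m + 2) ^ 2 = 1 + (9 * (m + 1) ^ 2 - 6 * (m + 1)) by ring, zpow_add₀ hq0,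
      zpow_add_one₀ (by norm_num)]
    norm_num
    ring
  have e := (summable_thetaTerm one_ne_zero hq0 hq).hasSum
  rw [← (Int.divModEquiv 3).symm.hasSum_iff, ← (Equiv.prodComm _ _).hasSum_iff] at e
  have e' := e.prod_fiberwise (g := ![∑' k, thetaTerm 1 (q ^ 9) k,
      -q * ∑' k, thetaTerm (q ^ 6)⁻¹ (q ^ 9) k, -q * ∑' k, thetaTerm (q ^ 6)⁻¹ (q ^ 9) k]) (by
    intro b
    fin_cases b
    · simpa [mul_comm] using t0
    · simpa [mul_comm] using t1
    · simpa [mul_comm] using t2)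
  rw [← e'.tsum_eq, tsum_fintype, Fin.sum_univ_three]
  simp
  ring

theorem stmt9 (q : ℂ) (hq0 : 0 < ‖q‖) (hq : ‖q‖ < 1) :
    poch q q / poch (-q) q = Jam 9 18 q - 2 * q * Jam 3 18 q := by
  have h0 : q ≠ 0 := norm_pos_iff.mp hq0
  have hq9 : ‖q ^ 9‖ < 1 := by
    rw [norm_pow]
    exact pow_lt_one₀ (norm_nonneg _) hq (by norm_num)
  have h9 : q ^ 9 ≠ 0 := pow_ne_zero _ h0
  have h6 : q ^ 6 ≠ 0 := pow_ne_zero _ h0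
  have e1 : (q ^ 6)⁻¹ * q ^ 9 = q ^ 3 := by field_simp
  have e2 : q ^ 6 * q ^ 9 = q ^ 15 := by ring
  have e3 : (q ^ 9) ^ 2 = q ^ 18 := by ring
  rw [← tsum_thetaTerm_one h0 hq, tsum_thetaTerm_trisection h0 hq,
    tsum_thetaTerm one_ne_zero h9 hq9, tsum_thetaTerm (inv_ne_zero h6) h9 hq9]
  simp only [Jam, inv_inv, inv_one, one_mul, e1, e2, e3]
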